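/- arXiv:2211.04416 — 2 statements merged into one kernel-verified Lean document; each statement's English description precedes it below -/
import Mathlib

section
/- Let n, d ∈ ℕ and let f ∈ ℝ[x₁,…,xₙ] be nonnegative on ℝⁿ with deg f = 2d. If the homogeneous component f_{2d} of f of degree 2d is not a sum of squares of polynomials, then for every t ≥ 0 the heat-evolved polynomial 𝔭_f(·,t) is nonnegative on ℝⁿ but is not a sum of squares of polynomials. -/
open MvPolynomial Finset

/-- The Laplace operator `Δ = ∂₁² + ⋯ + ∂ₙ²` on polynomials. -/
noncomputable def lap {n : ℕ} (p : MvPolynomial (Fin n) ℝ) : MvPolynomial (Fin n) ℝ :=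
  ∑ i, MvPolynomial.pderiv i (MvPolynomial.pderiv i p)

/-- The heat evolution of a polynomial: `𝔭_f(·,t) = Σ_k t^k Δ^k f / k!` (a finite sum,
since `Δ^k f = 0` for `2k > deg f`). -/
noncomputable def heatEvol {n : ℕ} (f : MvPolynomial (Fin n) ℝ) (t : ℝ) :
    MvPolynomial (Fin n) ℝ :=
  ∑ k ∈ Finset.range (f.totalDegree + 1), (t ^ k / (k.factorial : ℝ)) • (lap^[k] f)

/-- The Laplace operator as a linear map. -/
noncomputable def lapLinear (n : ℕ) : MvPolynomial (Fin n) ℝ →ₗ[ℝ] MvPolynomial (Fin n) ℝ :=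
  ∑ i, (pderiv i).toLinearMap ∘ₗ (pderiv i).toLinearMap

theorem lapLinear_apply {n : ℕ} (p : MvPolynomial (Fin n) ℝ) : lapLinear n p = lap p := by
  simp [lapLinear, lap]

theorem lap_iterate_eq {n : ℕ} (k : ℕ) (p : MvPolynomial (Fin n) ℝ) :
    lap^[k] p = (lapLinear n ^ k) p := by
  rw [Module.End.pow_apply, show (lap : MvPolynomial (Fin n) ℝ → _) = lapLinear n from
    funext fun p => (lapLinear_apply p).symm]

/-- The truncated exponential series of `t Δ`. -/
noncomputable def heatSum (n N : ℕ) (t : ℝ) :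
    MvPolynomial (Fin n) ℝ →ₗ[ℝ] MvPolynomial (Fin n) ℝ :=
  ∑ k ∈ range N, (t ^ k / (k.factorial : ℝ)) • lapLinear n ^ k

theorem heatEvol_eq_heatSum {n : ℕ} (f : MvPolynomial (Fin n) ℝ) (t : ℝ) :
    heatEvol f t = heatSum n (f.totalDegree + 1) t f := by
  simp [heatEvol, heatSum, lap_iterate_eq]

theorem pderiv_lapLinear {n : ℕ} (i : Fin n) (p : MvPolynomial (Fin n) ℝ) :
    pderiv i (lapLinear n p) = lapLinear n (pderiv i p) := by
  have comm : ∀ (j : Fin n) (q : MvPolynomial (Fin n) ℝ),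
      pderiv i (pderiv j q) = pderiv j (pderiv i q) := by
    intro j q
    have h : ⁅(pderiv i : Derivation ℝ (MvPolynomial (Fin n) ℝ) (MvPolynomial (Fin n) ℝ)),
        (pderiv j : Derivation ℝ (MvPolynomial (Fin n) ℝ) (MvPolynomial (Fin n) ℝ))⁆ = 0 := by
      refine MvPolynomial.derivation_ext fun k => ?_
      classical
      simp [Derivation.commutator_apply, pderiv_X, Pi.single_apply, apply_ite]
    have := congrArg (fun D : Derivation ℝ (MvPolynomial (Fin n) ℝ) (MvPolynomial (Fin n) ℝ) => D q) h
    simpa [Derivation.commutator_apply, sub_eq_zero] using this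
  simp [lapLinear, comm]

theorem lapLinear_X_mul {n : ℕ} (i : Fin n) (p : MvPolynomial (Fin n) ℝ) :
    lapLinear n (X i * p) = X i * lapLinear n p + 2 * pderiv i p := by
  classical
  have h : ∀ j : Fin n, pderiv j (pderiv j (X i * p)) =
      X i * pderiv j (pderiv j p) + (if j = i then 2 * pderiv i p else 0) := by
    intro j
    by_cases hj : j = i
    · subst hj
      simp [Derivation.leibniz]
      ring
    · simp [Derivation.leibniz, pderiv_X_of_ne (Ne.symm hj), hj]
  simp only [lapLinear_apply, lap, h, sum_add_distrib, mul_sum, sum_ite_eq', mem_univ, if_true]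

theorem lapLinear_pow_succ_X_mul {n : ℕ} (i : Fin n) (k : ℕ) (p : MvPolynomial (Fin n) ℝ) :
    (lapLinear n ^ (k + 1)) (X i * p) = X i * (lapLinear n ^ (k + 1)) p +
      (2 * (k + 1) : ℝ) • (lapLinear n ^ k) (pderiv i p) := by
  induction k generalizing p with
  | zero => simp [lapLinear_X_mul, two_smul, two_mul]
  | succ k ih =>
    have hsucc (j : ℕ) (q : MvPolynomial (Fin n) ℝ) :
        (lapLinear n ^ (j + 1)) q = (lapLinear n ^ j) (lapLinear n q) := by
      rw [pow_succ, Module.End.mul_apply]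
    rw [hsucc (k + 1), lapLinear_X_mul, map_add, ih, pderiv_lapLinear, ← hsucc, ← hsucc,
      two_mul (pderiv i p), map_add]
    push_cast
    module

theorem heatSum_succ_X_mul {n : ℕ} (i : Fin n) (N : ℕ) (t : ℝ) (p : MvPolynomial (Fin n) ℝ) :
    heatSum n (N + 1) t (X i * p) =
      X i * heatSum n (N + 1) t p + (2 * t) • heatSum n N t (pderiv i p) := by
  simp only [heatSum, LinearMap.sum_apply, LinearMap.smul_apply, LinearMap.add_apply,
    sum_range_succ', lapLinear_pow_succ_X_mul, mul_add (X i), mul_sum, smul_sum, smul_add,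
    sum_add_distrib]
  have h : ∀ k : ℕ, (t ^ (k + 1) / ((k + 1).factorial : ℝ)) •
      (2 * (k + 1) : ℝ) • (lapLinear n ^ k) (pderiv i p) =
      (2 * t) • (t ^ k / (k.factorial : ℝ)) • (lapLinear n ^ k) (pderiv i p) := by
    intro k
    rw [smul_smul, smul_smul]
    congr 1
    rw [Nat.factorial_succ]
    have : (k.factorial : ℝ) ≠ 0 := by positivity
    push_cast
    field_simp
    ring
  simp only [h, mul_smul_comm, pow_zero, Module.End.one_apply]
  ac_rfl

theorem heatSum_succ_one {n : ℕ} (N : ℕ) (t : ℝ) : heatSum n (N + 1) t 1 = 1 := by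
  have h : lapLinear n 1 = 0 := by simp [lapLinear_apply, lap]
  simp [heatSum, sum_range_succ', pow_succ, h]

/-- The truncated heat evolution of a monomial is a product of Gaussian moments, which are
characterized by their recurrence. -/
theorem eval_heatSum_monomial {n : ℕ} (t : ℝ) (x : Fin n → ℝ) (m : Fin n → ℕ → ℝ)
    (h0 : ∀ i, m i 0 = 1)
    (hm : ∀ i k, m i (k + 1) = x i * m i k + 2 * t * (k * m i (k - 1)))
    (N : ℕ) (a : Fin n →₀ ℕ) (ha : a.degree ≤ N) :
    eval x (heatSum n (N + 1) t (monomial a 1)) = ∏ i, m i (a i) := by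
  classical
  induction hD : a.degree using Nat.strong_induction_on generalizing N a with
  | _ D ih =>
  by_cases ha0 : a = 0
  · subst ha0
    simp [h0, heatSum_succ_one]
  obtain ⟨i, hi⟩ := Finsupp.ne_iff.1 ha0
  obtain ⟨b, rfl⟩ : ∃ b, a = Finsupp.single i 1 + b :=
    ⟨a - Finsupp.single i 1, (add_tsub_cancel_of_le
      (Finsupp.single_le_iff.2 (Nat.one_le_iff_ne_zero.2 hi))).symm⟩
  have hdeg : (Finsupp.single i 1 + b).degree = b.degree + 1 := by
    simp [map_add, add_comm]
  rw [hdeg] at ha hD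
  have hmon : (monomial (Finsupp.single i 1 + b) 1 : MvPolynomial (Fin n) ℝ) =
      X i * monomial b 1 := by
    simp [X, monomial_mul]
  have hprod : ∀ c : Fin n →₀ ℕ, (∀ j ≠ i, c j = b j) →
      ∏ j, m j (c j) = m i (c i) * ∏ j ∈ univ.erase i, m j (b j) := by
    intro c hc
    rw [← mul_prod_erase univ _ (mem_univ i)]
    congr 1
    exact prod_congr rfl fun j hj => by rw [hc j (ne_of_mem_erase hj)]
  have hb := ih b.degree (by omega) N b (by omega) rfl
  rw [hmon, heatSum_succ_X_mul, map_add, map_mul, eval_X, hb, smul_eval,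
    hprod b (fun _ _ => rfl), hprod (Finsupp.single i 1 + b)
      (fun j hj => by simp [Finsupp.single_eq_of_ne hj])]
  have hsi : (Finsupp.single i 1 + b : Fin n →₀ ℕ) i = b i + 1 := by simp [add_comm]
  rw [hsi, hm, pderiv_monomial, one_mul]
  by_cases hbi : b i = 0
  · simp [hbi]
    ring
  obtain ⟨c, rfl⟩ : ∃ c, b = Finsupp.single i 1 + c :=
    ⟨b - Finsupp.single i 1, (add_tsub_cancel_of_le
      (Finsupp.single_le_iff.2 (Nat.one_le_iff_ne_zero.2 hbi))).symm⟩
  have hcdeg : (Finsupp.single i 1 + c).degree = c.degree + 1 := by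
    simp [map_add, add_comm]
  rw [hcdeg] at ha hD
  obtain ⟨M, rfl⟩ : ∃ M, N = M + 1 := ⟨N - 1, by omega⟩
  have hc := ih c.degree (by omega) M c (by omega) rfl
  have hsmul (r : ℝ) : monomial c r = r • monomial c (1 : ℝ) := by simp [smul_monomial]
  rw [add_tsub_cancel_left, hsmul, map_smul, smul_eval, hc,
    hprod c (fun j hj => by simp [Finsupp.single_eq_of_ne hj])]
  simp
  ring

open MeasureTheory ProbabilityTheory in
theorem integral_pow_succ_gaussianReal (μ : ℝ) (v : NNReal) (k : ℕ) :
    ∫ y, y ^ (k + 1) ∂gaussianReal μ v =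
      μ * ∫ y, y ^ k ∂gaussianReal μ v + v * (k * ∫ y, y ^ (k - 1) ∂gaussianReal μ v) := by
  set g : ℝ → ℝ := fun s => Real.exp (μ * s + v * s ^ 2 / 2) with hg
  have hmgf : mgf id (gaussianReal μ v) = g := mgf_id_gaussianReal
  have hmoment (k : ℕ) : ∫ y, y ^ k ∂gaussianReal μ v = iteratedDeriv k g 0 := by
    rw [← hmgf, iteratedDeriv_mgf_zero (by simp [integrableExpSet_id_gaussianReal])]
    rfl
  have hcd : ContDiff ℝ ⊤ g := by fun_prop
  have hd (k : ℕ) (s : ℝ) : HasDerivAt (iteratedDeriv k g) (iteratedDeriv (k + 1) g s) s := by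
    rw [iteratedDeriv_succ]
    exact ((hcd.differentiable_iteratedDeriv k (WithTop.coe_lt_top _)) s).hasDerivAt
  have hlin (s : ℝ) : HasDerivAt (fun s : ℝ => μ + v * s) v s := by
    simpa using ((hasDerivAt_id s).const_mul (v : ℝ)).const_add μ
  have key (k : ℕ) : ∀ s, iteratedDeriv (k + 1) g s =
      (μ + v * s) * iteratedDeriv k g s + v * (k * iteratedDeriv (k - 1) g s) := by
    induction k with
    | zero =>
      intro s
      have h1 : HasDerivAt (fun s : ℝ => μ * s + v * s ^ 2 / 2) (μ + v * s) s := by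
        have := ((hasDerivAt_id s).const_mul μ).add
          (((hasDerivAt_pow 2 s).const_mul (v : ℝ)).div_const 2)
        exact this.congr_deriv (by simp; ring)
      rw [iteratedDeriv_one, h1.exp.deriv]
      simp [hg]
      ring
    | succ k ih =>
      intro s
      have h := ((hlin s).mul (hd k s)).add (((hd (k - 1) s).const_mul (k : ℝ)).const_mul (v : ℝ))
      rw [iteratedDeriv_succ (n := k + 1)]
      refine (congrArg (fun F => deriv F s) (funext ih)).trans (h.deriv.trans ?_)
      rcases k with _ | k
      · simp
        ring
      · simp
        ring
  rw [hmoment, hmoment, hmoment]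
  simpa using key k 0

open MeasureTheory ProbabilityTheory in
/-- The heat evolution is the expectation under a Gaussian perturbation of variance `2t`. -/
theorem eval_heatEvol_eq_integral {n : ℕ} (f : MvPolynomial (Fin n) ℝ) (t : NNReal)
    (x : Fin n → ℝ) :
    eval x (heatEvol f t) =
      ∫ y, eval y f ∂Measure.pi fun i => gaussianReal (x i) (2 * t) := by
  have hmoment : ∀ a : Fin n →₀ ℕ, Integrable (fun y : Fin n → ℝ => ∏ i, y i ^ a i)
      (Measure.pi fun i => gaussianReal (x i) (2 * t)) := by
    intro a
    refine Integrable.fintype_prod (f := fun i y => y ^ a i) fun i => ?_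
    rcases Nat.eq_zero_or_pos (a i) with h | h
    · simp [h]
    · have := (memLp_id_gaussianReal' (μ := x i) (v := 2 * t) (a i) (by simp)).integrable_norm_pow
        h.ne'
      exact (integrable_norm_iff (by fun_prop)).1 (by simpa using this)
  have hmon : ∀ a ∈ f.support, eval x (heatSum n (f.totalDegree + 1) t (monomial a 1)) =
      ∫ y, ∏ i, y i ^ a i ∂Measure.pi fun i => gaussianReal (x i) (2 * t) := by
    intro a ha
    rw [integral_fintype_prod_eq_prod (f := fun i (y : ℝ) => y ^ a i)]
    refine eval_heatSum_monomial (t : ℝ) x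
      (fun i k => ∫ y, y ^ k ∂gaussianReal (x i) (2 * t)) (by simp) (fun i k => ?_) _ a
      (le_totalDegree ha)
    simpa using integral_pow_succ_gaussianReal (x i) (2 * t) k
  simp only [fun y : Fin n → ℝ => eval_eq' y f]
  rw [integral_finsetSum _ fun a _ => (hmoment a).const_mul _, heatEvol_eq_heatSum]
  conv_lhs => arg 2; arg 2; rw [f.as_sum]
  rw [map_sum, map_sum]
  refine sum_congr rfl fun a ha => ?_
  rw [integral_const_mul, ← hmon a ha, ← smul_eval, ← map_smul, smul_monomial, smul_eq_mul, mul_one]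

theorem totalDegree_pderiv_le {σ R : Type*} [CommSemiring R] (i : σ) (p : MvPolynomial σ R) :
    (pderiv i p).totalDegree ≤ p.totalDegree - 1 := by
  classical
  conv_lhs => rw [p.as_sum, map_sum]
  refine totalDegree_finsetSum_le fun a ha => ?_
  rw [pderiv_monomial]
  by_cases hi : a i = 0
  · simp [hi]
  refine (totalDegree_monomial_le _ _).trans ?_
  have h := le_totalDegree ha
  have h2 : Finsupp.single i 1 ≤ a := Finsupp.single_le_iff.2 (Nat.one_le_iff_ne_zero.2 hi)
  have h3 := congrArg Finsupp.degree (tsub_add_cancel_of_le h2)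
  simp only [map_add, Finsupp.degree_single] at h3
  change (a - Finsupp.single i 1).degree ≤ _
  change a.degree ≤ _ at h
  omega

theorem totalDegree_lapLinear_pow_le {n : ℕ} (k : ℕ) (p : MvPolynomial (Fin n) ℝ) :
    ((lapLinear n ^ k) p).totalDegree ≤ p.totalDegree - k := by
  induction k with
  | zero => simp
  | succ k ih =>
    rw [pow_succ', Module.End.mul_apply, lapLinear_apply]
    refine totalDegree_finsetSum_le fun i _ => ?_
    have h1 := totalDegree_pderiv_le i (pderiv i ((lapLinear n ^ k) p))
    have h2 := totalDegree_pderiv_le i ((lapLinear n ^ k) p)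
    omega

theorem totalDegree_heatEvol_le {n : ℕ} (f : MvPolynomial (Fin n) ℝ) (t : ℝ) :
    (heatEvol f t).totalDegree ≤ f.totalDegree := by
  refine totalDegree_finsetSum_le fun k _ => (totalDegree_smul_le _ _).trans ?_
  rw [lap_iterate_eq]
  exact (totalDegree_lapLinear_pow_le k f).trans (Nat.sub_le _ _)

/-- The heat evolution preserves the top homogeneous component. -/
theorem homogeneousComponent_heatEvol {n : ℕ} (f : MvPolynomial (Fin n) ℝ) (t : ℝ)
    (hf : 0 < f.totalDegree) :
    homogeneousComponent f.totalDegree (heatEvol f t) =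
      homogeneousComponent f.totalDegree f := by
  rw [heatEvol, sum_range_succ', map_add, map_sum, sum_eq_zero]
  · simp
  · intro k _
    rw [map_smul, lap_iterate_eq, homogeneousComponent_eq_zero, smul_zero]
    have := totalDegree_lapLinear_pow_le (k + 1) f
    omega

theorem homogeneousComponent_mul_of_totalDegree_le {σ R : Type*} [CommSemiring R] {m n : ℕ}
    {p q : MvPolynomial σ R} (hp : p.totalDegree ≤ m) (hq : q.totalDegree ≤ n) :
    homogeneousComponent (m + n) (p * q) =
      homogeneousComponent m p * homogeneousComponent n q := by
  classical
  ext d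
  rw [coeff_homogeneousComponent]
  split_ifs with hd
  · rw [coeff_mul, coeff_mul]
    refine sum_congr rfl fun ⟨a, b⟩ hab => ?_
    have hab' := congrArg Finsupp.degree (mem_antidiagonal.1 hab)
    simp only [map_add] at hab'
    simp only [coeff_homogeneousComponent]
    rcases lt_trichotomy a.degree m with h | h | h
    · rw [if_neg h.ne, zero_mul,
        coeff_eq_zero_of_totalDegree_lt (f := q) (d := b) (by
          change q.totalDegree < b.degree; omega), mul_zero]
    · rw [if_pos h, if_pos (by omega)]
    · rw [if_neg h.ne', zero_mul,
        coeff_eq_zero_of_totalDegree_lt (f := p) (d := a) (by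
          change p.totalDegree < a.degree; omega), zero_mul]
  · exact (((homogeneousComponent_isHomogeneous m p).mul
      (homogeneousComponent_isHomogeneous n q)).coeff_eq_zero hd).symm

theorem IsSumSq.exists_list {R : Type*} [NonUnitalNonAssocSemiring R] {p : R} (h : IsSumSq p) :
    ∃ l : List R, p = (l.map fun q => q * q).sum := by
  induction h with
  | zero => exact ⟨[], rfl⟩
  | sq_add a _ ih =>
    obtain ⟨l, rfl⟩ := ih
    exact ⟨a :: l, by simp⟩

theorem homogeneousComponent_list_sum_mul_self {σ R : Type*} [CommSemiring R] {e : ℕ}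
    (l : List (MvPolynomial σ R)) (hl : ∀ q ∈ l, q.totalDegree ≤ e) :
    homogeneousComponent (2 * e) (l.map fun q => q * q).sum =
      (l.map fun q => homogeneousComponent e q * homogeneousComponent e q).sum := by
  induction l with
  | nil => simp
  | cons q l ih =>
    have hq := hl q (by simp)
    simp only [List.map_cons, List.sum_cons, map_add]
    rw [ih fun r hr => hl r (by simp [hr]), two_mul, homogeneousComponent_mul_of_totalDegree_le hq hq]

theorem eq_zero_of_list_sum_mul_self_eq_zero {σ : Type*} (l : List (MvPolynomial σ ℝ))
    (hl : (l.map fun q => q * q).sum = 0) : ∀ q ∈ l, q = 0 := by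
  intro q hq
  refine MvPolynomial.funext fun x => ?_
  have h := congrArg (eval x) hl
  rw [map_list_sum, List.map_map, map_zero] at h
  have hle := List.single_le_sum (l := l.map (eval x ∘ fun q => q * q))
    (fun y hy => by
      obtain ⟨r, -, rfl⟩ := List.mem_map.1 hy
      simpa using mul_self_nonneg (eval x r)) _ (List.mem_map_of_mem hq)
  rw [h] at hle
  simp only [Function.comp_apply, map_mul] at hle
  simpa using mul_self_eq_zero.1 (le_antisymm hle (mul_self_nonneg _))

theorem totalDegree_le_of_list_sum_mul_self {σ : Type*} {d : ℕ} (l : List (MvPolynomial σ ℝ))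
    (hl : (l.map fun q => q * q).sum.totalDegree ≤ 2 * d) :
    ∀ q ∈ l, q.totalDegree ≤ d := by
  have descend : ∀ k, (∀ q ∈ l, q.totalDegree ≤ d + k) → ∀ q ∈ l, q.totalDegree ≤ d := by
    intro k
    induction k with
    | zero => exact id
    | succ k ih =>
      refine fun h => ih fun q hq => ?_
      have hsum := homogeneousComponent_list_sum_mul_self l h
      rw [homogeneousComponent_eq_zero _ _ (by omega)] at hsum
      have hzero := eq_zero_of_list_sum_mul_self_eq_zero
        (l.map (homogeneousComponent (d + (k + 1)))) (by
          rw [List.map_map]; exact hsum.symm) _ (List.mem_map_of_mem hq)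
      refine Finset.sup_le fun a ha => ?_
      by_contra hlt
      have hle : a.degree ≤ d + (k + 1) := (le_totalDegree ha).trans (h q hq)
      have hcoeff := congrArg (coeff a) hzero
      change ¬ a.degree ≤ d + k at hlt
      rw [coeff_homogeneousComponent, if_pos (by omega)] at hcoeff
      exact mem_support_iff.1 ha (by simpa using hcoeff)
  refine descend (l.map totalDegree).sum fun q hq => ?_
  exact (List.le_sum_of_mem (List.mem_map_of_mem hq)).trans (Nat.le_add_left _ _)

theorem IsSumSq.homogeneousComponent {σ : Type*} {d : ℕ} {p : MvPolynomial σ ℝ} (h : IsSumSq p)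
    (hp : p.totalDegree ≤ 2 * d) : IsSumSq (MvPolynomial.homogeneousComponent (2 * d) p) := by
  obtain ⟨l, rfl⟩ := h.exists_list
  rw [homogeneousComponent_list_sum_mul_self l (totalDegree_le_of_list_sum_mul_self l hp)]
  clear h hp
  induction l with
  | nil => exact .zero
  | cons q l ih => exact .sq_add _ ih

/-- If `f ≥ 0` on `ℝⁿ` has degree `2d` and its top homogeneous part is not a sum of
squares, then for every `t ≥ 0` the heat-evolved polynomial `𝔭_f(·,t)` is nonnegative on
`ℝⁿ` but not a sum of squares. -/
theorem heatEvol_not_sos_of_top_not_sos (n d : ℕ) (hn : 0 < n) (hd : 0 < d)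
    (f : MvPolynomial (Fin n) ℝ) (hnonneg : ∀ x : Fin n → ℝ, 0 ≤ MvPolynomial.eval x f)
    (hdeg : f.totalDegree = 2 * d)
    (hnotsos : ¬ IsSumSq (MvPolynomial.homogeneousComponent (2 * d) f)) :
    ∀ t : ℝ, 0 ≤ t →
      (∀ x : Fin n → ℝ, 0 ≤ MvPolynomial.eval x (heatEvol f t)) ∧
      ¬ IsSumSq (heatEvol f t) := by
  intro t ht
  refine ⟨fun x => ?_, fun h => hnotsos ?_⟩
  · lift t to NNReal using ht
    rw [eval_heatEvol_eq_integral]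
    exact MeasureTheory.integral_nonneg hnonneg
  · have htop := h.homogeneousComponent ((totalDegree_heatEvol_le f t).trans hdeg.le)
    rwa [← hdeg, homogeneousComponent_heatEvol f t (by omega), hdeg] at htop
end

section
/- Let ν > 0, let g = (g₁,…,gₙ) : [0,∞) → ℝⁿ and h : [0,∞) → ℝ be continuous (depending on time only), and let p₀ ∈ ℝ[x₁,…,xₙ]. Define G(t) = ∫₀ᵗ g(s) ds, H(t) = ∫₀ᵗ h(s) ds, and p(x,t) = e^{H(t)}·(Θ_{νt} ∗ p₀)(x + G(t)) for t > 0, p(x,0) = p₀(x), where Θ_{νt} is the n-dimensional heat kernel. Then p(·,t) is a polynomial function for each t ≥ 0 and p satisfies ∂_t p(x,t) = νΔp(x,t) + g(t)·∇p(x,t) + h(t)·p(x,t) on ℝⁿ × (0,∞) with p(x,0) = p₀(x). -/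
open MeasureTheory MvPolynomial Real Set

/-- The `n`-dimensional heat kernel `Θ_s(y) = (4πs)^{-n/2} exp(−‖y‖²/(4s))`. -/
noncomputable def heatKernel (n : ℕ) (s : ℝ) (y : Fin n → ℝ) : ℝ :=
  (4 * π * s) ^ (-(n : ℝ) / 2) * Real.exp (-(∑ i, (y i) ^ 2) / (4 * s))

/-- The solution `p(x,t) = e^{H(t)}·(Θ_{νt} ∗ p₀)(x + G(t))` of the dual equation,
with `G(t) = ∫₀ᵗ g(s) ds` and `H(t) = ∫₀ᵗ h(s) ds`, and `p(x,0) = p₀(x)`. -/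
noncomputable def dualSol (n : ℕ) (ν : ℝ) (g : ℝ → Fin n → ℝ) (h : ℝ → ℝ)
    (p₀ : MvPolynomial (Fin n) ℝ) (x : Fin n → ℝ) (t : ℝ) : ℝ :=
  if t = 0 then MvPolynomial.eval x p₀
  else Real.exp (∫ s in (0 : ℝ)..t, h s) *
    ∫ y : Fin n → ℝ,
      MvPolynomial.eval (fun i => x i + (∫ s in (0 : ℝ)..t, g s i) - y i) p₀ *
        heatKernel n (ν * t) y

/-- The `i`-th partial derivative of `u` at `x`. -/
noncomputable def pd {n : ℕ} (i : Fin n) (u : (Fin n → ℝ) → ℝ) (x : Fin n → ℝ) : ℝ :=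
  deriv (fun s => u (Function.update x i s)) (x i)

/-- The second partial derivative of `u` in direction `i` at `x`. -/
noncomputable def pd2 {n : ℕ} (i : Fin n) (u : (Fin n → ℝ) → ℝ) (x : Fin n → ℝ) : ℝ :=
  iteratedDeriv 2 (fun s => u (Function.update x i s)) (x i)

/-- The one-dimensional heat kernel. -/
noncomputable def heatKernelReal (s y : ℝ) : ℝ :=
  (4 * π * s) ^ (-(1 : ℝ) / 2) * Real.exp (-y ^ 2 / (4 * s))

/-- The heat polynomials: `heatPoly s m` is the solution at time `s` of the one-dimensional heat
equation with initial value `X ^ m`. -/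
noncomputable def heatPoly (s : ℝ) : ℕ → Polynomial ℝ
  | 0 => 1
  | 1 => Polynomial.X
  | m + 2 => Polynomial.X * heatPoly s (m + 1) + Polynomial.C (2 * s * (m + 1)) * heatPoly s m

theorem derivative_heatPoly_succ (s : ℝ) (m : ℕ) :
    Polynomial.derivative (heatPoly s (m + 1)) = Polynomial.C ((m : ℝ) + 1) * heatPoly s m := by
  induction m using Nat.twoStepInduction with
  | zero => simp [heatPoly]
  | one =>
    simp [heatPoly, ← two_mul]
    exact (map_ofNat Polynomial.C 2).symm
  | more k ih₁ ih₂ =>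
    have e : heatPoly s (k + 1 + 1) =
        Polynomial.X * heatPoly s (k + 1) + Polynomial.C (2 * s * (k + 1)) * heatPoly s k := rfl
    rw [heatPoly, Polynomial.derivative_add, Polynomial.derivative_mul, Polynomial.derivative_C_mul,
      ih₁, ih₂, e]
    simp only [Polynomial.derivative_X, map_add, map_mul, map_one, map_natCast, map_ofNat,
      Nat.cast_add, Nat.cast_one]
    push_cast
    ring

/-- Chain rule for the heat polynomials, incorporating the heat equation. -/
theorem hasDerivAt_eval_heatPoly {z s : ℝ → ℝ} {z' s' t : ℝ} (hz : HasDerivAt z z' t)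
    (hs : HasDerivAt s s' t) (m : ℕ) :
    HasDerivAt (fun τ => (heatPoly (s τ) m).eval (z τ))
      (s' * (heatPoly (s t) m).derivative.derivative.eval (z t) +
        z' * (heatPoly (s t) m).derivative.eval (z t)) t := by
  induction m using Nat.twoStepInduction with
  | zero => simpa [heatPoly] using hasDerivAt_const t (1 : ℝ)
  | one => simpa [heatPoly] using hz
  | more k ih₁ ih₂ =>
    have key := (hz.mul ih₂).add (((hs.const_mul 2).mul_const ((k : ℝ) + 1)).mul ih₁)
    have e : (fun τ => (heatPoly (s τ) (k + 2)).eval (z τ)) =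
        (z * fun τ => (heatPoly (s τ) (k + 1)).eval (z τ)) +
          (fun τ => 2 * s τ * ((k : ℝ) + 1)) * fun τ => (heatPoly (s τ) k).eval (z τ) := by
      funext τ
      simp [heatPoly]
    rw [e]
    refine key.congr_deriv ?_
    have d := congrArg (Polynomial.eval (z t)) (derivative_heatPoly_succ (s t) k)
    simp only [Polynomial.eval_mul, Polynomial.eval_C] at d
    simp only [heatPoly, Polynomial.derivative_add, Polynomial.derivative_mul,
      Polynomial.derivative_X, Polynomial.derivative_C, Polynomial.eval_add, Polynomial.eval_mul,
      Polynomial.eval_X, Polynomial.eval_C, zero_mul, zero_add, one_mul]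
    rw [d]
    ring

theorem integrable_eval_mul_heatKernelReal {s : ℝ} (hs : 0 < s) (q : Polynomial ℝ) :
    Integrable fun y => q.eval y * heatKernelReal s y := by
  induction q using Polynomial.induction_on' with
  | add p q hp hq => exact (hp.add hq).congr (.of_forall fun y => by simp [add_mul])
  | monomial k a =>
    have hk : (-1 : ℝ) < k := by linarith [k.cast_nonneg (α := ℝ)]
    have := (integrable_rpow_mul_exp_neg_mul_sq (b := 1 / (4 * s)) (by positivity) hk).const_mul
      (a * (4 * π * s) ^ (-(1 : ℝ) / 2))
    refine this.congr (.of_forall fun y => ?_)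
    simp only [heatKernelReal, Polynomial.eval_monomial, Real.rpow_natCast]
    ring_nf

theorem hasDerivAt_heatKernelReal {s : ℝ} (hs : 0 < s) (y : ℝ) :
    HasDerivAt (heatKernelReal s) (-(y / (2 * s)) * heatKernelReal s y) y := by
  have h₁ : HasDerivAt (fun y : ℝ => -y ^ 2 / (4 * s)) (-(y / (2 * s))) y := by
    refine (((hasDerivAt_pow 2 y).neg).div_const (4 * s)).congr_deriv ?_
    push_cast
    field_simp
    ring
  refine (h₁.exp.const_mul ((4 * π * s) ^ (-(1 : ℝ) / 2))).congr_deriv ?_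
  rw [heatKernelReal]
  ring

theorem integral_eval_mul_id_mul_heatKernelReal {s : ℝ} (hs : 0 < s) (q : Polynomial ℝ) :
    ∫ y, q.eval y * y * heatKernelReal s y =
      2 * s * ∫ y, q.derivative.eval y * heatKernelReal s y := by
  have hi := integrable_eval_mul_heatKernelReal hs
  have hX : Integrable fun y => q.eval y * y * heatKernelReal s y :=
    (hi (q * Polynomial.X)).congr (.of_forall fun y => by simp)
  have e : ∀ y, q.eval y * (-(y / (2 * s)) * heatKernelReal s y) =
      -(1 / (2 * s)) * (q.eval y * y * heatKernelReal s y) := fun y => by ring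
  have h := integral_mul_deriv_eq_deriv_mul_of_integrable
    (fun y _ => q.hasDerivAt y) (fun y _ => hasDerivAt_heatKernelReal hs y)
    ((hX.const_mul (-(1 / (2 * s)))).congr (.of_forall fun y => (e y).symm))
    (hi q.derivative) (hi q)
  simp_rw [e] at h
  rw [integral_const_mul] at h
  field_simp at h
  linarith

theorem integral_heatKernelReal {s : ℝ} (hs : 0 < s) : ∫ y, heatKernelReal s y = 1 := by
  have e : ∀ y : ℝ, -y ^ 2 / (4 * s) = -(1 / (4 * s)) * y ^ 2 := fun y => by ring
  simp_rw [heatKernelReal, e]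
  rw [integral_const_mul, integral_gaussian, div_div_eq_mul_div, div_one,
    show π * (4 * s) = 4 * π * s by ring, Real.sqrt_eq_rpow, ← Real.rpow_add (by positivity)]
  norm_num

theorem integral_sub_pow_mul_heatKernelReal {s : ℝ} (hs : 0 < s) (z : ℝ) (m : ℕ) :
    ∫ y, (z - y) ^ m * heatKernelReal s y = (heatPoly s m).eval z := by
  have hi (q : Polynomial ℝ) := integrable_eval_mul_heatKernelReal hs q
  have step (k : ℕ) : ∫ y, (z - y) ^ (k + 1) * heatKernelReal s y =
      z * (∫ y, (z - y) ^ k * heatKernelReal s y) +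
        2 * s * k * ∫ y, (z - y) ^ (k - 1) * heatKernelReal s y := by
    have ibp := integral_eval_mul_id_mul_heatKernelReal hs ((Polynomial.C z - Polynomial.X) ^ k)
    have h₁ := (hi ((Polynomial.C z - Polynomial.X) ^ k)).const_mul z
    have h₂ := hi ((Polynomial.C z - Polynomial.X) ^ k * Polynomial.X)
    have e : ∀ y, (z - y) ^ (k + 1) * heatKernelReal s y =
        z * ((z - y) ^ k * heatKernelReal s y) - (z - y) ^ k * y * heatKernelReal s y :=
      fun y => by ring
    simp only [Polynomial.eval_mul, Polynomial.eval_pow, Polynomial.eval_sub, Polynomial.eval_C,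
      Polynomial.eval_X, Polynomial.derivative_pow, Polynomial.derivative_sub,
      Polynomial.derivative_C, Polynomial.derivative_X, zero_sub, mul_neg, mul_one, neg_mul,
      mul_assoc, integral_neg, integral_const_mul, Polynomial.eval_neg] at ibp h₁ h₂
    simp_rw [e, mul_assoc]
    rw [integral_sub h₁ h₂, integral_const_mul, ibp]
    ring
  induction m using Nat.twoStepInduction with
  | zero => simpa [heatPoly] using integral_heatKernelReal hs
  | one => simpa [heatPoly, integral_heatKernelReal hs] using step 0
  | more k ih₁ ih₂ =>
    rw [step, ih₂, Nat.add_sub_cancel, ih₁]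
    simp [heatPoly]

theorem heatKernel_eq_prod {s : ℝ} (hs : 0 < s) (n : ℕ) (y : Fin n → ℝ) :
    heatKernel n s y = ∏ i, heatKernelReal s (y i) := by
  simp only [heatKernel, heatKernelReal]
  rw [Finset.prod_mul_distrib, Finset.prod_const, ← Real.exp_sum, Finset.card_univ,
    Fintype.card_fin, ← Real.rpow_mul_natCast (by positivity), ← Finset.sum_div,
    Finset.sum_neg_distrib]
  congr 2
  ring

theorem integral_eval_sub_mul_heatKernel {s : ℝ} (hs : 0 < s) {n : ℕ}
    (p : MvPolynomial (Fin n) ℝ) (z : Fin n → ℝ) :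
    ∫ y, MvPolynomial.eval (fun i => z i - y i) p * heatKernel n s y =
      ∑ m ∈ p.support, p.coeff m * ∏ i, (heatPoly s (m i)).eval (z i) := by
  have e : ∀ y, MvPolynomial.eval (fun i => z i - y i) p * heatKernel n s y =
      ∑ m ∈ p.support, p.coeff m * ∏ i, ((z i - y i) ^ m i * heatKernelReal s (y i)) := fun y => by
    rw [MvPolynomial.eval_eq', heatKernel_eq_prod hs, Finset.sum_mul]
    simp_rw [Finset.prod_mul_distrib, mul_assoc]
  have hi (m : Fin n →₀ ℕ) : Integrable fun y : Fin n → ℝ =>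
      ∏ i, ((z i - y i) ^ m i * heatKernelReal s (y i)) := by
    refine Integrable.fintype_prod (f := fun i y => (z i - y) ^ m i * heatKernelReal s y)
      fun i => ?_
    exact (integrable_eval_mul_heatKernelReal hs ((Polynomial.C (z i) - Polynomial.X) ^ m i)).congr
      (.of_forall fun y => by simp)
  simp_rw [e]
  rw [integral_finsetSum _ fun m _ => (hi m).const_mul _]
  refine Finset.sum_congr rfl fun m _ => ?_
  rw [integral_const_mul,
    integral_fintype_prod_volume_eq_prod fun i y => (z i - y) ^ m i * heatKernelReal s y]
  simp_rw [integral_sub_pow_mul_heatKernelReal hs]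

theorem dualSol_eq_sum {n : ℕ} {ν : ℝ} (hν : 0 < ν) (g : ℝ → Fin n → ℝ) (h : ℝ → ℝ)
    (p₀ : MvPolynomial (Fin n) ℝ) (x : Fin n → ℝ) {t : ℝ} (ht : 0 < t) :
    dualSol n ν g h p₀ x t = Real.exp (∫ s in (0 : ℝ)..t, h s) *
      ∑ m ∈ p₀.support, p₀.coeff m *
        ∏ i, (heatPoly (ν * t) (m i)).eval (x i + ∫ s in (0 : ℝ)..t, g s i) := by
  rw [dualSol, if_neg ht.ne', integral_eval_sub_mul_heatKernel (mul_pos hν ht) p₀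
    fun i => x i + ∫ s in (0 : ℝ)..t, g s i]

theorem pd_eq_eval_derivative {n : ℕ} {i : Fin n} {u : (Fin n → ℝ) → ℝ} {x : Fin n → ℝ}
    {q : Polynomial ℝ} (hq : ∀ s, u (Function.update x i s) = q.eval s) :
    pd i u x = q.derivative.eval (x i) := by
  simp [pd, hq]

theorem pd2_eq_eval_derivative_derivative {n : ℕ} {i : Fin n} {u : (Fin n → ℝ) → ℝ}
    {x : Fin n → ℝ} {q : Polynomial ℝ} (hq : ∀ s, u (Function.update x i s) = q.eval s) :
    pd2 i u x = q.derivative.derivative.eval (x i) := by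
  have e : deriv (fun s => q.eval s) = fun s => q.derivative.eval s := funext fun s => q.deriv
  simp only [pd2, hq, iteratedDeriv_succ, iteratedDeriv_zero, e, Polynomial.deriv]

/-- The restriction of a sum of products of shifted univariate polynomials to the line through `x`
in the direction of the `i`-th coordinate. -/
noncomputable def lineRestriction {ι : Type*} {n : ℕ} (a : ℝ) (S : Finset ι) (c : ι → ℝ)
    (A : ι → Fin n → Polynomial ℝ) (G x : Fin n → ℝ) (i : Fin n) : Polynomial ℝ :=
  Polynomial.C a * ∑ m ∈ S, Polynomial.C (c m * ∏ j ∈ Finset.univ.erase i,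
    (A m j).eval (x j + G j)) * (A m i).comp (Polynomial.X + Polynomial.C (G i))

theorem eval_lineRestriction {ι : Type*} {n : ℕ} (a : ℝ) (S : Finset ι) (c : ι → ℝ)
    (A : ι → Fin n → Polynomial ℝ) (G x : Fin n → ℝ) (i : Fin n) (s : ℝ) :
    a * ∑ m ∈ S, c m * ∏ j, (A m j).eval (Function.update x i s j + G j) =
      (lineRestriction a S c A G x i).eval s := by
  simp only [lineRestriction, Polynomial.eval_mul, Polynomial.eval_C, Polynomial.eval_finsetSum,
    Polynomial.eval_comp, Polynomial.eval_add, Polynomial.eval_X]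
  congr 1
  refine Finset.sum_congr rfl fun m _ => ?_
  rw [← Finset.prod_erase_mul _ _ (Finset.mem_univ i), Function.update_self, mul_assoc]
  congr 2
  refine Finset.prod_congr rfl fun j hj => ?_
  rw [Function.update_of_ne (Finset.ne_of_mem_erase hj)]

theorem derivative_lineRestriction {ι : Type*} {n : ℕ} (a : ℝ) (S : Finset ι) (c : ι → ℝ)
    (A : ι → Fin n → Polynomial ℝ) (G x : Fin n → ℝ) (i : Fin n) :
    (lineRestriction a S c A G x i).derivative.eval (x i) =
      a * ∑ m ∈ S, c m * ((∏ j ∈ Finset.univ.erase i, (A m j).eval (x j + G j)) *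
        (A m i).derivative.eval (x i + G i)) := by
  simp only [lineRestriction, Polynomial.derivative_C_mul, Polynomial.derivative_sum,
    Polynomial.derivative_comp, Polynomial.derivative_add, Polynomial.derivative_X,
    Polynomial.derivative_C, add_zero, one_mul, Polynomial.eval_mul, Polynomial.eval_C,
    Polynomial.eval_finsetSum, Polynomial.eval_comp, Polynomial.eval_add, Polynomial.eval_X,
    mul_assoc]

theorem derivative_derivative_lineRestriction {ι : Type*} {n : ℕ} (a : ℝ) (S : Finset ι)
    (c : ι → ℝ) (A : ι → Fin n → Polynomial ℝ) (G x : Fin n → ℝ) (i : Fin n) :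
    (lineRestriction a S c A G x i).derivative.derivative.eval (x i) =
      a * ∑ m ∈ S, c m * ((∏ j ∈ Finset.univ.erase i, (A m j).eval (x j + G j)) *
        (A m i).derivative.derivative.eval (x i + G i)) := by
  simp only [lineRestriction, Polynomial.derivative_C_mul, Polynomial.derivative_sum,
    Polynomial.derivative_comp, Polynomial.derivative_add, Polynomial.derivative_X,
    Polynomial.derivative_C, add_zero, one_mul, Polynomial.eval_mul, Polynomial.eval_C,
    Polynomial.eval_finsetSum, Polynomial.eval_comp, Polynomial.eval_add, Polynomial.eval_X,
    mul_assoc]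

theorem hasDerivAt_integral_of_continuousOn_Ici {f : ℝ → ℝ} (hf : ContinuousOn f (Ici 0)) {t : ℝ}
    (ht : 0 < t) : HasDerivAt (fun τ => ∫ s in (0 : ℝ)..τ, f s) (f t) t := by
  refine intervalIntegral.integral_hasDerivAt_right ?_ ?_ (hf.continuousAt (Ici_mem_nhds ht))
  · refine (hf.mono ?_).intervalIntegrable
    rw [uIcc_of_le ht.le]
    exact Icc_subset_Ici_self
  · exact (hf.mono Ioi_subset_Ici_self).stronglyMeasurableAtFilter isOpen_Ioi t ht

/-- For `ν > 0` and continuous, time-dependent-only coefficients `g, h`, the function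
`p(x,t) = e^{H(t)}·(Θ_{νt} ∗ p₀)(x + G(t))` is a polynomial in `x` for every `t ≥ 0` and
solves `∂_t p = νΔp + g(t)·∇p + h(t)·p` on `ℝⁿ × (0,∞)` with `p(·,0) = p₀`. -/
theorem dualSol_is_polynomial_and_solves (n : ℕ) (hn : 0 < n) (ν : ℝ) (hν : 0 < ν)
    (g : ℝ → Fin n → ℝ) (h : ℝ → ℝ)
    (hg : ∀ i, ContinuousOn (fun t => g t i) (Ici (0 : ℝ)))
    (hh : ContinuousOn h (Ici (0 : ℝ)))
    (p₀ : MvPolynomial (Fin n) ℝ) :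
    (∀ t : ℝ, 0 ≤ t → ∃ q : MvPolynomial (Fin n) ℝ,
      ∀ x : Fin n → ℝ, dualSol n ν g h p₀ x t = MvPolynomial.eval x q) ∧
    (∀ x : Fin n → ℝ, dualSol n ν g h p₀ x 0 = MvPolynomial.eval x p₀) ∧
    (∀ (x : Fin n → ℝ) (t : ℝ), 0 < t →
      HasDerivAt (fun s => dualSol n ν g h p₀ x s)
        (ν * (∑ i, pd2 i (fun y => dualSol n ν g h p₀ y t) x)
          + (∑ i, g t i * pd i (fun y => dualSol n ν g h p₀ y t) x)
          + h t * dualSol n ν g h p₀ x t) t) := by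
  refine ⟨fun t ht => ?_, fun x => by simp [dualSol], fun x t ht => ?_⟩
  · obtain rfl | ht := ht.eq_or_lt
    · exact ⟨p₀, fun x => by simp [dualSol]⟩
    · refine ⟨C (Real.exp (∫ s in (0 : ℝ)..t, h s)) * ∑ m ∈ p₀.support, C (p₀.coeff m) *
        ∏ i, Polynomial.aeval (X i + C (∫ s in (0 : ℝ)..t, g s i)) (heatPoly (ν * t) (m i)),
        fun x => ?_⟩
      have e (a : MvPolynomial (Fin n) ℝ) (q : Polynomial ℝ) :
          eval x (Polynomial.aeval a q) = q.eval (eval x a) := by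
        rw [← MvPolynomial.coe_aeval_eq_eval, RingHom.coe_coe, ← Polynomial.aeval_algHom_apply,
          Polynomial.coe_aeval_eq_eval]
      simp [dualSol_eq_sum hν g h p₀ x ht, e, map_sum, map_prod]
  · set G : Fin n → ℝ := fun i => ∫ s in (0 : ℝ)..t, g s i
    have hline (i : Fin n) (s : ℝ) := (dualSol_eq_sum hν g h p₀ (Function.update x i s) ht).trans
      (eval_lineRestriction _ p₀.support (fun m => p₀.coeff m)
        (fun m j => heatPoly (ν * t) (m j)) G x i s)
    have hpd (i : Fin n) := (pd_eq_eval_derivative (u := fun y => dualSol n ν g h p₀ y t)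
      (hline i)).trans (derivative_lineRestriction ..)
    have hpd2 (i : Fin n) := (pd2_eq_eval_derivative_derivative
      (u := fun y => dualSol n ν g h p₀ y t) (hline i)).trans
      (derivative_derivative_lineRestriction ..)
    simp_rw [hpd, hpd2]
    have hs : HasDerivAt (fun τ => ν * τ) ν t := by
      simpa using (hasDerivAt_id t).const_mul ν
    have hprod (m : Fin n →₀ ℕ) := HasDerivAt.fun_finsetProd (u := Finset.univ)
      fun i _ => hasDerivAt_eval_heatPoly
        ((hasDerivAt_integral_of_continuousOn_Ici (hg i) ht).const_add (x i)) hs (m i)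
    have hder := (hasDerivAt_integral_of_continuousOn_Ici hh ht).exp.mul
      (HasDerivAt.fun_sum (u := p₀.support) fun m _ => (hprod m).const_mul (p₀.coeff m))
    refine (hder.congr_of_eventuallyEq ?_).congr_deriv ?_
    · filter_upwards [lt_mem_nhds ht] with τ hτ using dualSol_eq_sum hν g h p₀ x hτ
    · rw [dualSol_eq_sum hν g h p₀ x ht]
      simp only [smul_eq_mul, Finset.mul_sum, mul_add, Finset.sum_add_distrib]
      rw [add_comm]
      congr 1
      · congr 1
        · rw [Finset.sum_comm]
          refine Finset.sum_congr rfl fun i _ => Finset.sum_congr rfl fun m _ => ?_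
          ring
        · rw [Finset.sum_comm]
          refine Finset.sum_congr rfl fun i _ => Finset.sum_congr rfl fun m _ => ?_
          ring
      · refine Finset.sum_congr rfl fun m _ => ?_
        ring
end
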